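/- Let X be a compact metric space, (φⱼ)ⱼ≥0 a sequence of multivalued self-maps of X. Then the Bowen-type entropy via separated sets equals the Adler–Konheim–McAndrew-type entropy via open covers: h_KTRT(φ₀,∞) = h_AKEK(φ₀,∞), where h_AKEK(φ₀,∞) := sup_𝒜 limsup_{n→∞} (1/n) log N(φ₀,∞,𝒜,n), the supremum over open covers 𝒜 of X, and N(φ₀,∞,𝒜,n) is the minimal number of product sets U₀×…×U_{n−1} with Uᵢ ∈ 𝒜 needed to cover Orbₙ(φ₀,∞). -/

import Mathlib

open Filter

noncomputable section

/-- A set `S` is `(q,ε)`-separated if any two distinct points of `S` are at `q`-distance `> ε`. -/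
def SepSet {α : Type*} (q : α → α → ℝ) (ε : ℝ) (S : Set α) : Prop :=
  ∀ ⦃x⦄, x ∈ S → ∀ ⦃y⦄, y ∈ S → x ≠ y → ε < q x y

/-- The maximal cardinality of a finite `(q,ε)`-separated subset of `A`. -/
def maxSep {α : Type*} (q : α → α → ℝ) (ε : ℝ) (A : Set α) : ℕ :=
  sSup {m | ∃ S : Set α, S ⊆ A ∧ SepSet q ε S ∧ S.Finite ∧ S.ncard = m}

/-- The minimal cardinality of a finite `(q,ε)`-spanning set in `A`. -/
def minSpan {α : Type*} (q : α → α → ℝ) (ε : ℝ) (A : Set α) : ℕ :=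
  sInf {m | ∃ R : Set α, R ⊆ A ∧ (∀ y ∈ A, ∃ x ∈ R, q x y ≤ ε) ∧ R.Finite ∧ R.ncard = m}

/-- The set of `n`-orbits of the sequence of multivalued maps `φ`. -/
def Orb {X : Type*} (φ : ℕ → X → Set X) (n : ℕ) : Set (Fin n → X) :=
  {x | ∀ (i : ℕ) (h : i + 1 < n), x ⟨i + 1, h⟩ ∈ φ i (x ⟨i, by omega⟩)}

/-- Topological entropy via separated sets (`Fin n → X` carries the sup metric). -/
def entSep {X : Type*} [MetricSpace X] (φ : ℕ → X → Set X) : EReal :=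
  ⨆ (ε : ℝ) (_ : 0 < ε),
    Filter.limsup
      (fun n : ℕ =>
        ((Real.log (maxSep (fun a b : Fin n → X => dist a b) ε (Orb φ n)) / n : ℝ) : EReal))
      Filter.atTop

/-- Topological entropy via spanning sets. -/
def entSpan {X : Type*} [MetricSpace X] (φ : ℕ → X → Set X) : EReal :=
  ⨆ (ε : ℝ) (_ : 0 < ε),
    Filter.limsup
      (fun n : ℕ =>
        ((Real.log (minSpan (fun a b : Fin n → X => dist a b) ε (Orb φ n)) / n : ℝ) : EReal))
      Filter.atTop

end

noncomputable section

/-- Minimal number of product sets `U₀ × … × U_{n−1}` with all `Uᵢ ∈ 𝒜` needed to cover the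
`n`-orbit set. -/
def coverN {X : Type*} (φ : ℕ → X → Set X) (𝒜 : Set (Set X)) (n : ℕ) : ℕ :=
  sInf {m | ∃ F : Finset (Fin n → Set X),
    (∀ U ∈ F, ∀ i, U i ∈ 𝒜) ∧ (Orb φ n ⊆ ⋃ U ∈ F, Set.univ.pi U) ∧ F.card = m}

/-- Adler–Konheim–McAndrew type entropy on orbits, via open covers. -/
def entCover {X : Type*} [TopologicalSpace X] (φ : ℕ → X → Set X) : EReal :=
  ⨆ (𝒜 : Set (Set X)) (_ : (∀ U ∈ 𝒜, IsOpen U) ∧ ⋃₀ 𝒜 = Set.univ),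
    Filter.limsup (fun n : ℕ => ((Real.log (coverN φ 𝒜 n) / n : ℝ) : EReal)) Filter.atTop

theorem cover_exists_aux {X : Type*} [TopologicalSpace X] [CompactSpace X]
    (φ : ℕ → X → Set X) (𝒜 : Set (Set X)) (h1 : ∀ U ∈ 𝒜, IsOpen U) (h2 : ⋃₀ 𝒜 = Set.univ)
    (n : ℕ) : ∃ F : Finset (Fin n → Set X),
    (∀ U ∈ F, ∀ i, U i ∈ 𝒜) ∧ (Orb φ n ⊆ ⋃ U ∈ F, Set.univ.pi U) ∧ F.card = coverN φ 𝒜 n := by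
  classical
  have key : {m | ∃ F : Finset (Fin n → Set X),
    (∀ U ∈ F, ∀ i, U i ∈ 𝒜) ∧ (Orb φ n ⊆ ⋃ U ∈ F, Set.univ.pi U) ∧ F.card = m}.Nonempty := by
    choose g hg hgx using fun x : X => (h2.ge (Set.mem_univ x) : x ∈ ⋃₀ 𝒜)
    obtain ⟨t, ht⟩ := (isCompact_univ (X := X)).elim_finite_subcover g (fun x => h1 _ (hg x))
      (fun x _ => Set.mem_iUnion.2 ⟨x, hgx x⟩)
    refine ⟨_, Fintype.piFinset (fun _ : Fin n => t.image g), ?_, ?_, rfl⟩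
    · intro U hU i
      obtain ⟨x, -, hx⟩ := Finset.mem_image.1 (Fintype.mem_piFinset.1 hU i)
      exact hx ▸ hg x
    · intro y _
      have hy : ∀ i, ∃ x ∈ t, y i ∈ g x := fun i => by
        simpa only [Set.mem_iUnion, exists_prop] using ht (Set.mem_univ (y i))
      choose c hc hcy using hy
      refine Set.mem_biUnion (x := fun i => g (c i)) ?_ (fun i _ => hcy i)
      exact Fintype.mem_piFinset.2 fun i => Finset.mem_image_of_mem _ (hc i)
  exact Nat.sInf_mem key

theorem sep_card_le_aux {X : Type*} [MetricSpace X]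
    (φ : ℕ → X → Set X) (𝒜 : Set (Set X)) (ε : ℝ) (hε : 0 < ε)
    (hA : ∀ U ∈ 𝒜, ∀ x ∈ U, ∀ y ∈ U, dist x y ≤ ε)
    (n : ℕ) (F : Finset (Fin n → Set X)) (hF : ∀ U ∈ F, ∀ i, U i ∈ 𝒜)
    (hc : Orb φ n ⊆ ⋃ U ∈ F, Set.univ.pi U) (S : Set (Fin n → X)) (hS : S ⊆ Orb φ n)
    (hsep : SepSet (fun a b : Fin n → X => dist a b) ε S) : S.ncard ≤ F.card := by
  classical
  have hex : ∀ x ∈ S, ∃ U ∈ F, x ∈ Set.univ.pi U := by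
    intro x hx
    simpa only [Set.mem_iUnion, exists_prop] using hc (hS hx)
  choose! f hf hfx using hex
  rw [← Set.ncard_coe_finset]
  refine Set.ncard_le_ncard_of_injOn f (fun x hx => hf x hx) ?_ F.finite_toSet
  intro x hx y hy hxy
  by_contra hne
  refine absurd (hsep hx hy hne) (not_lt.2 ?_)
  refine (dist_pi_le_iff hε.le).2 fun i => ?_
  refine hA (f x i) (hF _ (hf x hx) i) _ (hfx x hx i trivial) _ ?_
  rw [hxy]
  exact hfx y hy i trivial

theorem sep_bdd_aux {X : Type*} [MetricSpace X] [CompactSpace X]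
    (φ : ℕ → X → Set X) (ε : ℝ) (hε : 0 < ε) :
    ∃ 𝒜 : Set (Set X), (∀ U ∈ 𝒜, IsOpen U) ∧ ⋃₀ 𝒜 = Set.univ ∧
      ∀ n, ∀ S ⊆ Orb φ n, SepSet (fun a b : Fin n → X => dist a b) ε S →
        S.ncard ≤ coverN φ 𝒜 n := by
  have h1 : ∀ U ∈ Set.range (fun x : X => Metric.ball x (ε / 2)), IsOpen U := by
    rintro _ ⟨x, rfl⟩
    exact Metric.isOpen_ball
  have h2 : ⋃₀ Set.range (fun x : X => Metric.ball x (ε / 2)) = Set.univ := by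
    refine Set.eq_univ_of_forall fun x => ⟨_, ⟨x, rfl⟩, Metric.mem_ball_self (by positivity)⟩
  refine ⟨_, h1, h2, fun n S hS hsep => ?_⟩
  obtain ⟨F, hF, hc, hcard⟩ := cover_exists_aux φ _ h1 h2 n
  rw [← hcard]
  refine sep_card_le_aux φ _ ε hε ?_ n F hF hc S hS hsep
  rintro _ ⟨z, rfl⟩ x hx y hy
  have := dist_triangle_right x y z
  simp only [Metric.mem_ball] at hx hy
  linarith

theorem coverN_le_aux {X : Type*} [MetricSpace X] [CompactSpace X]
    (φ : ℕ → X → Set X) (𝒜 : Set (Set X)) (h1 : ∀ U ∈ 𝒜, IsOpen U) (h2 : ⋃₀ 𝒜 = Set.univ) :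
    ∃ ε : ℝ, 0 < ε ∧
      ∀ n, coverN φ 𝒜 n ≤ maxSep (fun a b : Fin n → X => dist a b) ε (Orb φ n) := by
  classical
  obtain ⟨δ, hδ, hL⟩ := lebesgue_number_lemma_of_metric_sUnion (isCompact_univ (X := X)) h1 h2.ge
  refine ⟨δ / 2, by positivity, fun n => ?_⟩
  obtain ⟨ℬ, -, -, hb⟩ := sep_bdd_aux φ (δ / 2) (by positivity)
  have hbdd : BddAbove {m | ∃ S : Set (Fin n → X), S ⊆ Orb φ n ∧
      SepSet (fun a b : Fin n → X => dist a b) (δ / 2) S ∧ S.Finite ∧ S.ncard = m} := by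
    refine ⟨coverN φ ℬ n, ?_⟩
    rintro m ⟨S, hS, hsep, -, rfl⟩
    exact hb n S hS hsep
  obtain ⟨S, hS, hsep, hfin, hcard⟩ := Nat.sSup_mem
    (by exact ⟨0, ∅, Set.empty_subset _, fun x hx => absurd hx (Set.notMem_empty x),
      Set.finite_empty, Set.ncard_empty _⟩) hbdd
  have hspan : ∀ y ∈ Orb φ n, ∃ x ∈ S, dist x y ≤ δ / 2 := by
    intro y hy
    by_contra! hcon
    have hyS : y ∉ S := fun h => by
      have := hcon y h
      rw [dist_self] at this
      linarith
    have hle := le_csSup hbdd ⟨insert y S, Set.insert_subset hy hS, ?_, hfin.insert y, rfl⟩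
    · rw [Set.ncard_insert_of_notMem hyS hfin, ← hcard] at hle
      omega
    · rintro a (rfl | ha) b (rfl | hb) hab
      · exact absurd rfl hab
      · simpa only [dist_comm] using hcon b hb
      · exact hcon a ha
      · exact hsep ha hb hab
  choose g hg hgs using fun x : X => hL x (Set.mem_univ x)
  unfold maxSep
  rw [← hcard, Set.ncard_eq_toFinset_card S hfin]
  refine le_trans (Nat.sInf_le ⟨hfin.toFinset.image (fun x i => g (x i)), ?_, ?_, rfl⟩)
    Finset.card_image_le
  · intro U hU i
    obtain ⟨x, -, rfl⟩ := Finset.mem_image.1 hU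
    exact hg _
  · intro y hy
    obtain ⟨x, hx, hxy⟩ := hspan y hy
    refine Set.mem_biUnion (Finset.mem_image_of_mem _ (hfin.mem_toFinset.2 hx)) ?_
    intro i _
    refine hgs (x i) ?_
    rw [Metric.mem_ball, dist_comm]
    have := dist_le_pi_dist x y i
    linarith

theorem limsup_log_aux (a b : ℕ → ℕ) (h : ∀ n, a n ≤ b n) :
    Filter.limsup (fun n : ℕ => ((Real.log (a n) / n : ℝ) : EReal)) Filter.atTop ≤
    Filter.limsup (fun n : ℕ => ((Real.log (b n) / n : ℝ) : EReal)) Filter.atTop := by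
  refine Filter.limsup_le_limsup (Filter.Eventually.of_forall fun n => ?_)
  refine EReal.coe_le_coe_iff.2 (div_le_div_of_nonneg_right ?_ (Nat.cast_nonneg n))
  rcases Nat.eq_zero_or_pos (a n) with h0 | h0
  · rw [h0, Nat.cast_zero, Real.log_zero]
    exact Real.log_natCast_nonneg _
  · exact Real.log_le_log (by exact_mod_cast h0) (by exact_mod_cast h n)

/-- On a compact metric space, the Bowen-type separated-set entropy on orbits
coincides with the Adler–Konheim–McAndrew type open-cover entropy on orbits. -/
theorem entSep_eq_entCover
    {X : Type*} [MetricSpace X] [CompactSpace X]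
    (φ : ℕ → X → Set X) (hne : ∀ j x, (φ j x).Nonempty) :
    entSep φ = entCover φ := by
  apply le_antisymm
  · refine iSup₂_le fun ε hε => ?_
    obtain ⟨𝒜, h1, h2, hb⟩ := sep_bdd_aux φ ε hε
    refine le_trans (limsup_log_aux _ _ fun n => ?_) (le_iSup₂ (f := fun (𝒜 : Set (Set X))
      (_ : (∀ U ∈ 𝒜, IsOpen U) ∧ ⋃₀ 𝒜 = Set.univ) => Filter.limsup
        (fun n : ℕ => ((Real.log (coverN φ 𝒜 n) / n : ℝ) : EReal)) Filter.atTop) 𝒜 ⟨h1, h2⟩)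
    refine csSup_le' ?_
    rintro m ⟨S, hS, hsep, -, rfl⟩
    exact hb n S hS hsep
  · refine iSup₂_le fun 𝒜 h => ?_
    obtain ⟨ε, hε, hb⟩ := coverN_le_aux φ 𝒜 h.1 h.2
    exact le_trans (limsup_log_aux _ _ hb) (le_iSup₂ (f := fun (ε : ℝ) (_ : 0 < ε) =>
      Filter.limsup (fun n : ℕ => ((Real.log (maxSep (fun a b : Fin n → X => dist a b) ε
        (Orb φ n)) / n : ℝ) : EReal)) Filter.atTop) ε hε)

end
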